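/- Let n ≥ 0 and let φ : P_n → P_n be a group automorphism of the n-qubit real Pauli group. Then there exists U in the extended gate group G_n' such that U P U⁻¹ = φ(P) for every P ∈ P_n. Moreover, U is unique up to sign: if U and V both belong to G_n' and satisfy U P U⁻¹ = V P V⁻¹ = φ(P) for all P ∈ P_n, then V = U or V = −U. -/

import Mathlib

open Matrix

noncomputable section

namespace RealStab

abbrev Mat (n : ℕ) := Matrix (Fin n → Fin 2) (Fin n → Fin 2) ℝ

/-- The real Pauli matrix `X`. -/
def X2 : Matrix (Fin 2) (Fin 2) ℝ := !![0, 1; 1, 0]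

/-- The real Pauli matrix `Z`. -/
def Z2 : Matrix (Fin 2) (Fin 2) ℝ := !![1, 0; 0, -1]

/-- The set `{I, X, Z, XZ}` of single-qubit Pauli matrices. -/
def pauliSet : Set (Matrix (Fin 2) (Fin 2) ℝ) := {1, X2, Z2, X2 * Z2}

/-- The `n`-fold Kronecker (tensor) product `P 0 ⊗ ⋯ ⊗ P (n-1)`, represented as a
matrix indexed by functions `Fin n → Fin 2` (a `2^n × 2^n` matrix). -/
def tensorN {n : ℕ} (P : Fin n → Matrix (Fin 2) (Fin 2) ℝ) : Mat n :=
  Matrix.of fun x y => ∏ i, P i (x i) (y i)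

/-- The `n`-qubit real Pauli group `P_n`, as a set of `2^n × 2^n` real matrices. -/
def PauliGroup (n : ℕ) : Set (Mat n) :=
  { M | ∃ a : Fin 2, ∃ P : Fin n → Matrix (Fin 2) (Fin 2) ℝ,
      (∀ i, P i ∈ pauliSet) ∧ M = (-1 : ℝ) ^ (a : ℕ) • tensorN P }


/-- The Hadamard matrix `H = (1/√2)·!![1,1;1,−1]`. -/
def Hmat : Matrix (Fin 2) (Fin 2) ℝ := (Real.sqrt 2)⁻¹ • !![1, 1; 1, -1]

/-- The single-qubit gate `G` applied on qubit `i`: the Kronecker product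
`I^{⊗(i-1)} ⊗ G ⊗ I^{⊗(n-i)}`. -/
def gate1 {n : ℕ} (i : Fin n) (G : Matrix (Fin 2) (Fin 2) ℝ) : Mat n :=
  tensorN (fun j => if j = i then G else 1)

/-- The controlled-Z gate on qubits `i` and `j`: diagonal, with entry `−1` exactly
on basis states where both bits `i` and `j` equal `1`. For `j = i+1` this is
`I^{⊗(i-1)} ⊗ CZ ⊗ I^{⊗(n-i-1)}` with `CZ = diag(1,1,1,−1)`. -/
def CZgate {n : ℕ} (i j : Fin n) : Mat n :=
  Matrix.diagonal (fun x => if x i = 1 ∧ x j = 1 then -1 else 1)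

/-- The set of generating gate matrices: `H`-gates and `Z`-gates on each qubit, and
`CZ`-gates on adjacent pairs of qubits. -/
def gateSet (n : ℕ) : Set (Mat n) :=
  { M | (∃ i : Fin n, M = gate1 i Hmat) ∨ (∃ i : Fin n, M = gate1 i Z2) ∨
        (∃ i : Fin n, ∃ h : (i : ℕ) + 1 < n, M = CZgate i ⟨(i : ℕ) + 1, h⟩) }

/-- The gate group `G_n`: the subgroup of `GL(2^n, ℝ)` (units of the matrix ring)
generated by all `H`-gates, `Z`-gates and `CZ`-gates. -/
def GateGroup (n : ℕ) : Subgroup (Mat n)ˣ :=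
  Subgroup.closure { U : (Mat n)ˣ | (U : Mat n) ∈ gateSet n }

/-- The extended gate group `G_n'`: the subgroup of `GL(2^n, ℝ)` generated by `−I`
together with all `H`-gates, `Z`-gates and `CZ`-gates. -/
def ExtGateGroup (n : ℕ) : Subgroup (Mat n)ˣ :=
  Subgroup.closure ({ U : (Mat n)ˣ | (U : Mat n) ∈ gateSet n } ∪ {(-1 : (Mat n)ˣ)})

/-- The `n`-qubit real Pauli group as a subgroup of the units of the matrix ring
(the subgroup generated by — equivalently, consisting of — the Pauli matrices). -/
def PauliUnits (n : ℕ) : Subgroup (Mat n)ˣ :=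
  Subgroup.closure { U : (Mat n)ˣ | (U : Mat n) ∈ PauliGroup n }

section Gates

variable {n : ℕ}

section Tensor

variable (A B : Fin n → Matrix (Fin 2) (Fin 2) ℝ)

theorem tensorN_mul : tensorN A * tensorN B = tensorN (fun i => A i * B i) := by
  ext x y
  simp only [Matrix.mul_apply, tensorN, of_apply]
  rw [Finset.prod_univ_sum]
  simp [Fintype.piFinset_univ, Finset.prod_mul_distrib]

theorem tensorN_one : tensorN (fun _ : Fin n => 1) = 1 := by
  ext x y
  simp [tensorN, one_apply, Finset.prod_boole, funext_iff]

end Tensor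

section SingleQubit

variable (i : Fin n) (A B : Matrix (Fin 2) (Fin 2) ℝ)

theorem gate1_apply (x y : Fin n → Fin 2) :
    gate1 i A x y = A (x i) (y i) *
      ∏ j ∈ Finset.univ.erase i, (1 : Matrix (Fin 2) (Fin 2) ℝ) (x j) (y j) := by
  rw [gate1, tensorN, of_apply, ← Finset.mul_prod_erase _ _ (Finset.mem_univ i)]
  congr 1
  · simp
  · exact Finset.prod_congr rfl fun j hj => by rw [if_neg (Finset.ne_of_mem_erase hj)]

theorem gate1_mul : gate1 i A * gate1 i B = gate1 i (A * B) := by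
  rw [gate1, gate1, gate1, tensorN_mul]
  congr 1
  ext1 j
  split_ifs <;> simp

theorem gate1_one : gate1 i 1 = 1 := by
  simp [gate1, tensorN_one]

theorem gate1_neg : gate1 i (-A) = -gate1 i A := by
  ext x y
  simp [gate1_apply]

theorem gate1_commute {i j : Fin n} (hij : i ≠ j) : Commute (gate1 i A) (gate1 j B) := by
  rw [Commute, SemiconjBy, gate1, gate1, tensorN_mul, tensorN_mul]
  congr 1
  ext1 k
  split_ifs <;> simp_all

theorem gate1_Z2 : gate1 i Z2 = diagonal fun x => Z2 (x i) (x i) := by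
  ext x y
  rw [gate1_apply, diagonal_apply]
  split_ifs with h
  · rw [h, Finset.prod_congr rfl fun j _ => one_apply_eq (y j), Finset.prod_const_one, mul_one]
  · obtain ⟨j, hj⟩ := Function.ne_iff.1 h
    by_cases hji : j = i
    · subst hji
      have : Z2 (x j) (y j) = 0 := by
        generalize x j = a at *
        generalize y j = b at *
        fin_cases a <;> fin_cases b <;> simp_all [Z2]
      simp [this]
    · exact mul_eq_zero_of_right _
        (Finset.prod_eq_zero (Finset.mem_erase.2 ⟨hji, Finset.mem_univ j⟩) (one_apply_ne hj))

end SingleQubit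

theorem X2_mul_self : X2 * X2 = 1 := by
  ext i j; fin_cases i <;> fin_cases j <;> simp [X2]

theorem Z2_mul_self : Z2 * Z2 = 1 := by
  ext i j; fin_cases i <;> fin_cases j <;> simp [Z2]

theorem X2_mul_Z2 : X2 * Z2 = -(Z2 * X2) := by
  ext i j; fin_cases i <;> fin_cases j <;> simp [X2, Z2]

theorem Hmat_mul_self : Hmat * Hmat = 1 := by
  have h : (√2 : ℝ)⁻¹ * (√2)⁻¹ = 1 / 2 := by rw [← mul_inv, Real.mul_self_sqrt] <;> norm_num
  ext i j
  fin_cases i <;> fin_cases j <;> simp [Hmat, h] <;> norm_num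

theorem Hmat_mul_X2 : Hmat * X2 = Z2 * Hmat := by
  ext i j; fin_cases i <;> fin_cases j <;> simp [Hmat, X2, Z2]

theorem Hmat_mul_Z2 : Hmat * Z2 = X2 * Hmat := by
  ext i j; fin_cases i <;> fin_cases j <;> simp [Hmat, X2, Z2]

/-- A single-qubit involution acting on qubit `i`, as a unit. -/
def involutionGate (i : Fin n) (A : Matrix (Fin 2) (Fin 2) ℝ) (h : A * A = 1) : (Mat n)ˣ where
  val := gate1 i A
  inv := gate1 i A
  val_inv := by rw [gate1_mul, h, gate1_one]
  inv_val := by rw [gate1_mul, h, gate1_one]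

/-- The Pauli matrix `X` acting on qubit `i`. -/
def X (i : Fin n) : (Mat n)ˣ := involutionGate i X2 X2_mul_self

/-- The Pauli matrix `Z` acting on qubit `i`. -/
def Z (i : Fin n) : (Mat n)ˣ := involutionGate i Z2 Z2_mul_self

/-- The Hadamard gate acting on qubit `i`. -/
def H (i : Fin n) : (Mat n)ˣ := involutionGate i Hmat Hmat_mul_self

section Relations

variable (i : Fin n)

theorem X_mul_self : X i * X i = 1 := Units.ext (X i).mul_inv
theorem Z_mul_self : Z i * Z i = 1 := Units.ext (Z i).mul_inv
theorem H_mul_self : H i * H i = 1 := Units.ext (H i).mul_inv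

theorem X_mul_Z : X i * Z i = -(Z i * X i) := by
  ext1
  change gate1 i X2 * gate1 i Z2 = -(gate1 i Z2 * gate1 i X2)
  rw [gate1_mul, gate1_mul, X2_mul_Z2, gate1_neg]

theorem Z_mul_X : Z i * X i = -(X i * Z i) := by rw [X_mul_Z, neg_neg]

theorem H_conj_X : H i * X i * (H i)⁻¹ = Z i := by
  rw [mul_inv_eq_iff_eq_mul]
  ext1
  change gate1 i Hmat * gate1 i X2 = gate1 i Z2 * gate1 i Hmat
  rw [gate1_mul, gate1_mul, Hmat_mul_X2]

theorem H_conj_Z : H i * Z i * (H i)⁻¹ = X i := by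
  rw [mul_inv_eq_iff_eq_mul]
  ext1
  change gate1 i Hmat * gate1 i Z2 = gate1 i X2 * gate1 i Hmat
  rw [gate1_mul, gate1_mul, Hmat_mul_Z2]

variable {i} {j : Fin n}

theorem involutionGate_commute (hij : i ≠ j) {A B : Matrix (Fin 2) (Fin 2) ℝ} (hA : A * A = 1)
    (hB : B * B = 1) : Commute (involutionGate i A hA) (involutionGate j B hB) :=
  Units.ext (gate1_commute A B hij)

theorem commute_X_X : Commute (X i) (X j) := by
  by_cases h : i = j
  · rw [h]
  · exact involutionGate_commute h _ _

theorem commute_Z_Z : Commute (Z i) (Z j) := by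
  by_cases h : i = j
  · rw [h]
  · exact involutionGate_commute h _ _

theorem commute_X_Z (h : i ≠ j) : Commute (X i) (Z j) := involutionGate_commute h _ _

theorem commute_H_X (h : i ≠ j) : Commute (H i) (X j) := involutionGate_commute h _ _

theorem commute_H_Z (h : i ≠ j) : Commute (H i) (Z j) := involutionGate_commute h _ _

end Relations

/-- The generators `X i`, `Z i` and `-1` of the Pauli group. -/
def pauliGenerators (n : ℕ) : Set (Mat n)ˣ := Set.range X ∪ Set.range Z ∪ {-1}

theorem one_mem_pauliSet : (1 : Matrix (Fin 2) (Fin 2) ℝ) ∈ pauliSet := by simp [pauliSet]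

theorem gate1_mem_PauliGroup (i : Fin n) {A : Matrix (Fin 2) (Fin 2) ℝ} (hA : A ∈ pauliSet) :
    gate1 i A ∈ PauliGroup n :=
  ⟨0, fun j => if j = i then A else 1,
    fun j => by dsimp only; split_ifs <;> [exact hA; exact one_mem_pauliSet], by simp [gate1]⟩

theorem X_mem (i : Fin n) : X i ∈ PauliUnits n :=
  Subgroup.subset_closure (gate1_mem_PauliGroup i (by simp [pauliSet]))

theorem Z_mem (i : Fin n) : Z i ∈ PauliUnits n :=
  Subgroup.subset_closure (gate1_mem_PauliGroup i (by simp [pauliSet]))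

theorem neg_one_mem : -1 ∈ PauliUnits n :=
  Subgroup.subset_closure ⟨1, fun _ => 1, fun _ => one_mem_pauliSet, by simp [tensorN_one]⟩

theorem tensorN_mem_closure {P : Fin n → Matrix (Fin 2) (Fin 2) ℝ} (hP : ∀ i, P i ∈ pauliSet) :
    ∃ U ∈ Subgroup.closure (pauliGenerators n), (U : Mat n) = tensorN P := by
  have key (s : Finset (Fin n)) : ∃ U ∈ Subgroup.closure (pauliGenerators n),
      (U : Mat n) = tensorN fun j => if j ∈ s then P j else 1 := by
    induction s using Finset.induction_on with
    | empty => exact ⟨1, one_mem _, by simp [tensorN_one]⟩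
    | insert i s his ih =>
      obtain ⟨U, hU, hUs⟩ := ih
      have hX : X i ∈ Subgroup.closure (pauliGenerators n) :=
        Subgroup.subset_closure (.inl (.inl ⟨i, rfl⟩))
      have hZ : Z i ∈ Subgroup.closure (pauliGenerators n) :=
        Subgroup.subset_closure (.inl (.inr ⟨i, rfl⟩))
      obtain ⟨V, hV, hVi⟩ : ∃ V ∈ Subgroup.closure (pauliGenerators n),
          (V : Mat n) = gate1 i (P i) := by
        obtain h | h | h | h := hP i
        · exact ⟨1, one_mem _, by rw [h, gate1_one, Units.val_one]⟩
        · exact ⟨X i, hX, by rw [h]; rfl⟩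
        · exact ⟨Z i, hZ, by rw [h]; rfl⟩
        · exact ⟨X i * Z i, mul_mem hX hZ, by rw [h, ← gate1_mul]; rfl⟩
      refine ⟨V * U, mul_mem hV hU, ?_⟩
      rw [Units.val_mul, hVi, hUs, gate1, tensorN_mul]
      congr 1
      ext1 j
      by_cases hj : j = i
      · subst hj
        simp [his]
      · simp [hj]
  simpa using key Finset.univ

theorem PauliUnits_eq_closure : PauliUnits n = Subgroup.closure (pauliGenerators n) := by
  refine le_antisymm ?_ ?_
  · rw [PauliUnits, Subgroup.closure_le]
    rintro U ⟨a, P, hP, hU⟩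
    obtain ⟨V, hV, hVP⟩ := tensorN_mem_closure hP
    rw [← hVP] at hU
    fin_cases a
    · have : U = V := Units.ext (by simpa using hU)
      rwa [this]
    · have : U = -1 * V := Units.ext (by simpa using hU)
      rw [this]
      exact mul_mem (Subgroup.subset_closure (.inr rfl)) hV
  · rw [Subgroup.closure_le]
    rintro _ ((⟨i, rfl⟩ | ⟨i, rfl⟩) | rfl)
    exacts [X_mem i, Z_mem i, neg_one_mem]

/-- A subgroup containing all `X i`, `Z i` and `-1` contains the Pauli group. -/
theorem PauliUnits_le {K : Subgroup (Mat n)ˣ} (hX : ∀ i, X i ∈ K) (hZ : ∀ i, Z i ∈ K)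
    (h : -1 ∈ K) : PauliUnits n ≤ K := by
  rw [PauliUnits_eq_closure, Subgroup.closure_le]
  rintro _ ((⟨i, rfl⟩ | ⟨i, rfl⟩) | rfl)
  exacts [hX i, hZ i, h]

/-- The elements that commute with `q` up to sign. -/
def signCentralizer (q : (Mat n)ˣ) : Subgroup (Mat n)ˣ where
  carrier := {p | Commute p q ∨ p * q = -(q * p)}
  one_mem' := .inl (Commute.one_left q)
  mul_mem' := by
    rintro a b (ha | ha) (hb | hb)
    · exact .inl (ha.mul_left hb)
    · right; rw [mul_assoc, hb, mul_neg, ← mul_assoc, ha.eq, mul_assoc]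
    · right; rw [mul_assoc, hb.eq, ← mul_assoc, ha, neg_mul, mul_assoc]
    · left; rw [Commute, SemiconjBy, mul_assoc, hb, mul_neg, ← mul_assoc, ha, neg_mul, neg_neg,
        mul_assoc]
  inv_mem' := by
    rintro a (ha | ha)
    · exact .inl ha.inv_left
    · right
      rw [inv_mul_eq_iff_eq_mul, mul_neg, ← mul_assoc, ha, neg_mul, neg_neg, mul_inv_cancel_right]

theorem mem_signCentralizer_comm {p q : (Mat n)ˣ} (h : p ∈ signCentralizer q) :
    q ∈ signCentralizer p := by
  obtain h | h := h
  · exact .inl h.symm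
  · exact .inr (by rw [h, neg_neg])

theorem neg_one_mem_signCentralizer (q : (Mat n)ˣ) : -1 ∈ signCentralizer q :=
  .inl (Commute.neg_one_left q)

/-- Two elements of the Pauli group commute or anticommute. -/
theorem commute_or_anticommute {p q : (Mat n)ˣ} (hp : p ∈ PauliUnits n) (hq : q ∈ PauliUnits n) :
    Commute p q ∨ p * q = -(q * p) := by
  have hX (i : Fin n) : PauliUnits n ≤ signCentralizer (X i) := by
    refine PauliUnits_le (fun j => .inl commute_X_X) (fun j => ?_) (neg_one_mem_signCentralizer _)
    by_cases h : i = j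
    · subst h; exact .inr (Z_mul_X i)
    · exact .inl (commute_X_Z h).symm
  have hZ (i : Fin n) : PauliUnits n ≤ signCentralizer (Z i) := by
    refine PauliUnits_le (fun j => ?_) (fun j => .inl commute_Z_Z) (neg_one_mem_signCentralizer _)
    by_cases h : i = j
    · subst h; exact .inr (X_mul_Z i)
    · exact .inl (commute_X_Z (Ne.symm h))
  exact PauliUnits_le (fun i => mem_signCentralizer_comm (hX i hq))
    (fun i => mem_signCentralizer_comm (hZ i hq)) (neg_one_mem_signCentralizer _) hp

theorem exists_eq_smul_one {M : Mat n} (hX : ∀ i, Commute (X i).val M)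
    (hZ : ∀ i, Commute (Z i).val M) : ∃ s : ℝ, M = s • 1 := by
  have hdiag : M = diagonal fun x => M x x := by
    ext x y
    rw [diagonal_apply]
    split_ifs with h
    · rw [h]
    · obtain ⟨i, hi⟩ := Function.ne_iff.1 h
      have h1 : gate1 i Z2 * M = M * gate1 i Z2 := hZ i
      rw [gate1_Z2] at h1
      have h2 := congrFun (congrFun h1 x) y
      rw [diagonal_mul, mul_diagonal] at h2
      generalize x i = a at *
      generalize y i = b at *
      fin_cases a <;> fin_cases b <;> simp [Z2] at hi h2 ⊢ <;> linarith
  set m : (Fin n → Fin 2) → ℝ := fun x => M x x with hm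
  have hflip (x : Fin n → Fin 2) (i : Fin n) (a : Fin 2) : m (Function.update x i a) = m x := by
    by_cases hxa : x i = a
    · rw [← hxa, Function.update_eq_self]
    · have h1 : gate1 i X2 * M = M * gate1 i X2 := hX i
      rw [hdiag] at h1
      have h2 := congrFun (congrFun h1 x) (Function.update x i a)
      rw [diagonal_mul, mul_diagonal] at h2
      have h3 : gate1 i X2 x (Function.update x i a) = 1 := by
        rw [gate1_apply, Finset.prod_congr rfl (g := fun _ => 1), Finset.prod_const_one, mul_one,
          Function.update_self]
        · generalize x i = b at hxa
          fin_cases a <;> fin_cases b <;> simp [X2] at hxa ⊢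
        · intro j hj
          rw [Function.update_of_ne (Finset.ne_of_mem_erase hj), one_apply_eq]
      rw [h3] at h2
      linarith
  have hconst (x : Fin n → Fin 2) (s : Finset (Fin n)) : m (s.piecewise x 0) = m 0 := by
    induction s using Finset.induction_on with
    | empty => simp
    | insert i s _ ih => rw [Finset.piecewise_insert, hflip, ih]
  refine ⟨m 0, ?_⟩
  rw [hdiag, smul_one_eq_diagonal]
  congr 1
  ext1 x
  simpa using hconst x Finset.univ

section Controlled

/-- The gate `(1 + c) / 2 + b (1 - c) / 2`: apply `b` on the `-1`-eigenspace of the involution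
`c`. -/
def ctrl (c b : Mat n) : Mat n := (1 / 2 : ℝ) • (1 + c + b * (1 - c))

theorem ctrl_mul {c b b' : Mat n} (hc : c * c = 1) (hb' : Commute b' c) :
    ctrl c b * ctrl c b' = ctrl c (b * b') := by
  have e₁ : (1 + c) * (1 + c) = (2 : ℝ) • (1 + c) := by
    rw [mul_add, add_mul, add_mul, hc, two_smul]; noncomm_ring
  have e₂ : (1 - c) * (1 - c) = (2 : ℝ) • (1 - c) := by
    rw [mul_sub, sub_mul, sub_mul, hc, two_smul]; noncomm_ring
  have e₃ : (1 + c) * (1 - c) = 0 := by rw [mul_sub, add_mul, add_mul, hc]; noncomm_ring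
  have e₄ : (1 - c) * (1 + c) = 0 := by rw [mul_add, sub_mul, sub_mul, hc]; noncomm_ring
  have e₅ : (1 + c) * b' = b' * (1 + c) := ((Commute.one_left b').add_left hb'.symm).eq
  have e₆ : (1 - c) * b' = b' * (1 - c) := ((Commute.one_left b').sub_left hb'.symm).eq
  have key : (1 + c + b * (1 - c)) * (1 + c + b' * (1 - c)) =
      (2 : ℝ) • (1 + c + b * b' * (1 - c)) := by
    calc _ = (1 + c) * (1 + c) + ((1 + c) * b') * (1 - c) + b * ((1 - c) * (1 + c)) +
          b * ((1 - c) * b') * (1 - c) := by noncomm_ring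
      _ = (1 + c) * (1 + c) + b' * ((1 + c) * (1 - c)) + b * ((1 - c) * (1 + c)) +
          b * b' * ((1 - c) * (1 - c)) := by rw [e₅, e₆]; simp only [mul_assoc]
      _ = _ := by
        rw [e₁, e₂, e₃, e₄, mul_zero, mul_zero, add_zero, add_zero, mul_smul_comm, ← smul_add]
  rw [ctrl, ctrl, ctrl, smul_mul_smul_comm, key, smul_smul]
  norm_num

theorem ctrl_one (c : Mat n) : ctrl c 1 = 1 := by
  have : 1 + c + 1 * (1 - c) = (2 : ℝ) • 1 := by rw [two_smul]; noncomm_ring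
  rw [ctrl, this, smul_smul]
  norm_num

theorem ctrl_self {c : Mat n} (hc : c * c = 1) : ctrl c c = c := by
  have : 1 + c + c * (1 - c) = (2 : ℝ) • c := by rw [mul_sub, hc, two_smul]; noncomm_ring
  rw [ctrl, this, smul_smul]
  norm_num

theorem ctrl_neg_one (c : Mat n) : ctrl c (-1) = c := by
  have : 1 + c + -1 * (1 - c) = (2 : ℝ) • c := by rw [two_smul]; noncomm_ring
  rw [ctrl, this, smul_smul]
  norm_num

theorem ctrl_comm {c b : Mat n} (h : Commute c b) : ctrl c b = ctrl b c := by
  rw [ctrl, ctrl, mul_sub, mul_sub, h.eq]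
  congr 1
  noncomm_ring

theorem units_mul_ctrl_mul_inv (g c b : (Mat n)ˣ) :
    g.val * ctrl c b * g⁻¹.val = ctrl (g * c * g⁻¹).val (g * b * g⁻¹).val := by
  simp only [ctrl, Units.val_mul, mul_smul_comm, smul_mul_assoc, mul_add, add_mul, mul_sub,
    sub_mul, mul_one, Units.mul_inv]
  simp only [mul_assoc, Units.inv_mul_cancel_left]

theorem commute_ctrl {p c b : Mat n} (hc : Commute p c) (hb : Commute p b) :
    Commute p (ctrl c b) :=
  (((Commute.one_right p).add_right hc).add_right
    (hb.mul_right ((Commute.one_right p).sub_right hc))).smul_right _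

/-- Conjugation by `ctrl c (y * x)` exchanges the involutions `x` and `y` anticommuting
with `c`. -/
theorem conj_eq_of_val_eq_ctrl {g c x y : (Mat n)ˣ} (hg : (g : Mat n) = ctrl c (y * x : (Mat n)ˣ))
    (hx : x * x = 1) (hy : y * y = 1) (hxc : x * c = -(c * x)) (hyc : y * c = -(c * y)) :
    g * x * g⁻¹ = y := by
  rw [mul_inv_eq_iff_eq_mul]
  ext1
  replace hx : (x : Mat n) * x = 1 := by rw [← Units.val_mul, hx, Units.val_one]
  replace hy : (y : Mat n) * y = 1 := by rw [← Units.val_mul, hy, Units.val_one]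
  replace hxc : (c : Mat n) * x = -(x * c) := by
    rw [← Units.val_mul, ← Units.val_mul, hxc, Units.val_neg, neg_neg]
  replace hyc : (y : Mat n) * c = -(c * y) := by
    rw [← Units.val_mul, hyc, Units.val_neg, Units.val_mul]
  rw [Units.val_mul, Units.val_mul, hg, ctrl, smul_mul_assoc, mul_smul_comm, Units.val_mul]
  congr 1
  generalize (x : Mat n) = x at *
  generalize (y : Mat n) = y at *
  generalize (c : Mat n) = c at *
  calc (1 + c + y * x * (1 - c)) * x = x + c * x + y * (x * x) - y * x * (c * x) := by
        noncomm_ring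
    _ = x - x * c + y * (x * x) + y * (x * x) * c := by rw [hxc]; noncomm_ring
    _ = y + y * c + (y * y) * x * (1 - c) := by rw [hx, hy]; noncomm_ring
    _ = _ := by noncomm_ring

end Controlled

theorem H_mem_ext (i : Fin n) : H i ∈ ExtGateGroup n :=
  Subgroup.subset_closure (.inl (.inl ⟨i, rfl⟩))

theorem Z_mem_ext (i : Fin n) : Z i ∈ ExtGateGroup n :=
  Subgroup.subset_closure (.inl (.inr (.inl ⟨i, rfl⟩)))

/-- The controlled gate `ctrl c b` lies in the extended gate group. -/
def CtrlRealizable (c b : (Mat n)ˣ) : Prop :=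
  ∃ g ∈ ExtGateGroup n, (g : Mat n) = ctrl c b

theorem CtrlRealizable.conj {c b g : (Mat n)ˣ} (h : CtrlRealizable c b)
    (hg : g ∈ ExtGateGroup n) : CtrlRealizable (g * c * g⁻¹) (g * b * g⁻¹) := by
  obtain ⟨u, hu, huv⟩ := h
  refine ⟨g * u * g⁻¹, mul_mem (mul_mem hg hu) (inv_mem hg), ?_⟩
  rw [← units_mul_ctrl_mul_inv, Units.val_mul, Units.val_mul, huv]

theorem CtrlRealizable.symm {c b : (Mat n)ˣ} (h : CtrlRealizable c b) (hcb : Commute c b) :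
    CtrlRealizable b c := by
  obtain ⟨u, hu, huv⟩ := h
  exact ⟨u, hu, by rw [huv, ctrl_comm (hcb.units_val)]⟩

theorem CtrlRealizable.exists_conj {c x y : (Mat n)ˣ} (h : CtrlRealizable c (y * x))
    (hx : x * x = 1) (hy : y * y = 1) (hxc : x * c = -(c * x)) (hyc : y * c = -(c * y)) :
    ∃ g ∈ ExtGateGroup n, g * x * g⁻¹ = y ∧
      ∀ p, Commute p c → Commute p (y * x) → Commute p g := by
  obtain ⟨g, hg, hgv⟩ := h
  refine ⟨g, hg, conj_eq_of_val_eq_ctrl hgv hx hy hxc hyc, fun p hc hp => ?_⟩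
  ext1
  rw [Units.val_mul, Units.val_mul, hgv]
  exact commute_ctrl (hc.units_val)
    (hp.units_val)

/-- The elements commuting with the involution `c` whose `c`-controlled version is in the extended
gate group. -/
def ctrlSubgroup (c : (Mat n)ˣ) (hc : c * c = 1) : Subgroup (Mat n)ˣ where
  carrier := {b | Commute b c ∧ CtrlRealizable c b}
  one_mem' := ⟨Commute.one_left c, 1, one_mem _, by rw [Units.val_one, ctrl_one]⟩
  mul_mem' := by
    rintro a b ⟨ha, u, hu, hua⟩ ⟨hb, v, hv, hvb⟩
    refine ⟨ha.mul_left hb, u * v, mul_mem hu hv, ?_⟩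
    rw [Units.val_mul, hua, hvb, Units.val_mul,
      ctrl_mul (by rw [← Units.val_mul, hc, Units.val_one]) (hb.units_val)]
  inv_mem' := by
    rintro b ⟨hb, u, hu, hub⟩
    refine ⟨hb.inv_left, u⁻¹, inv_mem hu, Units.inv_eq_of_mul_eq_one_right ?_⟩
    rw [hub, ctrl_mul (by rw [← Units.val_mul, hc, Units.val_one])
      (hb.inv_left.units_val), Units.mul_inv, ctrl_one]

theorem CZgate_eq_ctrl (i j : Fin n) : CZgate i j = ctrl (Z i) (Z j) := by
  have hZ (i : Fin n) : (Z i : Mat n) = diagonal fun x => Z2 (x i) (x i) := gate1_Z2 i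
  rw [ctrl, hZ, hZ, ← diagonal_one, diagonal_add, diagonal_sub, diagonal_mul_diagonal,
    diagonal_add, ← diagonal_smul, CZgate]
  congr 1
  ext1 x
  simp only [Pi.smul_apply, smul_eq_mul]
  generalize x i = a
  generalize x j = b
  fin_cases a <;> fin_cases b <;> simp [Z2] <;> norm_num

theorem CZgate_mul_self (i j : Fin n) : CZgate i j * CZgate i j = 1 := by
  have hZ (i : Fin n) : (Z i : Mat n) * Z i = 1 := (Z i).mul_inv
  rw [CZgate_eq_ctrl, ctrl_mul (hZ i) (commute_Z_Z.units_val), hZ, ctrl_one]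

/-- The `CZ` gate as a unit. -/
def CZ (i j : Fin n) : (Mat n)ˣ where
  val := CZgate i j
  inv := CZgate i j
  val_inv := CZgate_mul_self i j
  inv_val := CZgate_mul_self i j

theorem CZ_mem_ext (i j : Fin n) (h : (j : ℕ) = i + 1) : CZ i j ∈ ExtGateGroup n := by
  have hj : j = ⟨i + 1, h ▸ j.2⟩ := Fin.ext h
  exact Subgroup.subset_closure (.inl (.inr (.inr ⟨i, h ▸ j.2, by rw [← hj]; rfl⟩)))

theorem Z_mul_Z_mul_self (i j : Fin n) : Z i * Z j * (Z i * Z j) = 1 := by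
  rw [commute_Z_Z.mul_mul_mul_comm, Z_mul_self, Z_mul_self, one_mul]

theorem ctrlRealizable_Z_Z_of_lt (d : ℕ) (i j : Fin n) (h : (j : ℕ) = i + 1 + d) :
    CtrlRealizable (Z i) (Z j) := by
  induction d generalizing j with
  | zero => exact ⟨CZ i j, CZ_mem_ext i j h, CZgate_eq_ctrl i j⟩
  | succ d ih =>
    let k : Fin n := ⟨i + 1 + d, by omega⟩
    have hik : i ≠ k := Fin.ne_of_val_ne (by simp only [k]; omega)
    have hkj : k ≠ j := Fin.ne_of_val_ne (by simp only [k]; omega)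
    have hk := ih k rfl
    have h₁ : CtrlRealizable (Z k) (Z j) := ⟨CZ k j, CZ_mem_ext k j h, CZgate_eq_ctrl k j⟩
    have h₂ := h₁.conj (H_mem_ext k)
    rw [H_conj_Z, (commute_H_Z hkj).mul_inv_cancel] at h₂
    obtain ⟨g, hg, hgk, hgc⟩ := CtrlRealizable.exists_conj (c := X k) (x := Z k) (y := Z j * Z k)
      (by rwa [mul_assoc, Z_mul_self, mul_one]) (Z_mul_self k) (Z_mul_Z_mul_self j k) (Z_mul_X k)
      (by rw [mul_assoc, Z_mul_X, mul_neg, ← mul_assoc, ← mul_assoc, (commute_X_Z hkj).eq])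
    have h₃ := hk.conj hg
    rw [hgk, (hgc (Z i) (commute_X_Z hik.symm).symm 
      ((commute_Z_Z.mul_right commute_Z_Z).mul_right commute_Z_Z)).symm.mul_inv_cancel] at h₃
    have h₄ := (ctrlSubgroup (Z i) (Z_mul_self i)).mul_mem
      ⟨commute_Z_Z.mul_left commute_Z_Z, h₃⟩ ⟨commute_Z_Z, hk⟩
    rw [mul_assoc, Z_mul_self, mul_one] at h₄
    exact h₄.2

theorem ctrlRealizable_Z_Z (i j : Fin n) : CtrlRealizable (Z i) (Z j) := by
  obtain h | h | h := lt_trichotomy i j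
  · exact ctrlRealizable_Z_Z_of_lt (j - (i + 1)) i j (by omega)
  · subst h
    exact ⟨Z i, Z_mem_ext i, (ctrl_self (Z i).mul_inv).symm⟩
  · exact (ctrlRealizable_Z_Z_of_lt (i - (j + 1)) j i (by omega)).symm commute_Z_Z

theorem ctrlRealizable_Z_X {i j : Fin n} (h : j ≠ i) : CtrlRealizable (Z i) (X j) := by
  have := (ctrlRealizable_Z_Z i j).conj (H_mem_ext j)
  rwa [H_conj_Z, (commute_H_Z h).mul_inv_cancel] at this

theorem ne_neg_self (u : (Mat n)ˣ) : u ≠ -u := fun h => by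
  have h' : (u : Mat n) = -u := congrArg Units.val h
  have h₂ : (2 : ℝ) • (u : Mat n) = 0 := by
    rw [two_smul]
    nth_rw 1 [h']
    exact neg_add_cancel _
  exact u.ne_zero ((smul_eq_zero.1 h₂).resolve_left two_ne_zero)

theorem neg_mem_of_neg_one_mem {K : Subgroup (Mat n)ˣ} (h : -1 ∈ K) {u : (Mat n)ˣ} (hu : u ∈ K) :
    -u ∈ K := by
  rw [← neg_one_mul]
  exact mul_mem h hu

theorem ctrlRealizable_Z_of_commute {i : Fin n} {b : (Mat n)ˣ} (hb : b ∈ PauliUnits n)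
    (hbi : Commute b (Z i)) : CtrlRealizable (Z i) b := by
  set R := ctrlSubgroup (Z i) (Z_mul_self i)
  have hneg : -1 ∈ R := ⟨Commute.neg_one_left _, Z i, Z_mem_ext i, (ctrl_neg_one _).symm⟩
  have hswap {a : (Mat n)ˣ} (ha : a ∈ PauliUnits n) (h : X i * a ∈ R) : a * X i ∈ R := by
    obtain h' | h' := commute_or_anticommute ha (X_mem i)
    · rwa [h'.eq]
    · rw [h']; exact neg_mem_of_neg_one_mem hneg h
  have hswap' {a : (Mat n)ˣ} (ha : a ∈ PauliUnits n) (h : a * X i ∈ R) : X i * a ∈ R := by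
    obtain h' | h' := commute_or_anticommute (X_mem i) ha
    · rwa [h'.eq]
    · rw [h']; exact neg_mem_of_neg_one_mem hneg h
  have hconj {a : (Mat n)ˣ} (ha : a ∈ PauliUnits n) (h : a ∈ R) : X i * a * X i ∈ R := by
    obtain h' | h' := commute_or_anticommute (X_mem i) ha
    · rwa [h'.eq, mul_assoc, X_mul_self, mul_one]
    · rw [h', neg_mul, mul_assoc, X_mul_self, mul_one]; exact neg_mem_of_neg_one_mem hneg h
  let K : Subgroup (Mat n)ˣ :=
    { carrier := {p | p ∈ PauliUnits n ∧ (p ∈ R ∨ X i * p ∈ R)}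
      one_mem' := ⟨one_mem _, .inl (one_mem _)⟩
      mul_mem' := by
        rintro a b ⟨ha, ha'⟩ ⟨hb, hb'⟩
        refine ⟨mul_mem ha hb, ?_⟩
        obtain ha' | ha' := ha' <;> obtain hb' | hb' := hb'
        · exact .inl (mul_mem ha' hb')
        · right
          have := mul_mem (hconj ha ha') hb'
          rwa [mul_assoc, ← mul_assoc (X i) (X i), X_mul_self, one_mul, mul_assoc] at this
        · right
          rw [← mul_assoc]
          exact mul_mem ha' hb'
        · left
          have := mul_mem (hswap ha ha') hb'
          rwa [mul_assoc, ← mul_assoc (X i) (X i), X_mul_self, one_mul] at this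
      inv_mem' := by
        rintro a ⟨ha, ha' | ha'⟩
        · exact ⟨inv_mem ha, .inl (inv_mem ha')⟩
        · refine ⟨inv_mem ha, .inr (hswap' (inv_mem ha) ?_)⟩
          have := inv_mem ha'
          rwa [_root_.mul_inv_rev, inv_eq_of_mul_eq_one_left (X_mul_self i)] at this }
  have hK : PauliUnits n ≤ K := by
    refine PauliUnits_le (fun j => ⟨X_mem j, ?_⟩)
      (fun j => ⟨Z_mem j, .inl ⟨commute_Z_Z, ctrlRealizable_Z_Z i j⟩⟩) ⟨neg_one_mem, .inl hneg⟩
    by_cases h : j = i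
    · subst h
      right
      rw [X_mul_self]
      exact one_mem _
    · exact .inl ⟨commute_X_Z h, ctrlRealizable_Z_X h⟩
  obtain h | h := (hK hb).2
  · exact h.2
  · have hXZ : Commute (X i) (Z i) := by
      have := h.1.mul_left hbi.inv_left
      rwa [mul_inv_cancel_right] at this
    exact absurd (hXZ.eq.symm.trans (X_mul_Z i)) (ne_neg_self _)

/-- The extended gate group normalizes the Pauli group. -/
theorem conj_mem_of_mem_ext {g p : (Mat n)ˣ} (hg : g ∈ ExtGateGroup n) (hp : p ∈ PauliUnits n) :
    g * p * g⁻¹ ∈ PauliUnits n := by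
  have key (u : (Mat n)ˣ) (hu : u⁻¹ = u) (hX : ∀ i, u * X i * u⁻¹ ∈ PauliUnits n)
      (hZ : ∀ i, u * Z i * u⁻¹ ∈ PauliUnits n) : u ∈ Subgroup.normalizer (PauliUnits n) := by
    have h : PauliUnits n ≤ (PauliUnits n).comap (MulAut.conj u).toMonoidHom :=
      PauliUnits_le hX hZ (by simpa using neg_one_mem)
    rw [Subgroup.mem_normalizer_iff]
    refine fun p => ⟨fun hp => h hp, fun hp => ?_⟩
    have : u * (u * p * u⁻¹) * u⁻¹ ∈ PauliUnits n := h hp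
    nth_rw 1 [← hu] at this
    nth_rw 3 [hu] at this
    simpa [mul_assoc] using this
  suffices ExtGateGroup n ≤ Subgroup.normalizer (PauliUnits n) from
    (Subgroup.mem_normalizer_iff.1 (this hg) p).1 hp
  rw [ExtGateGroup, Subgroup.closure_le]
  rintro u ((⟨i, hu⟩ | ⟨i, hu⟩ | ⟨i, hi, hu⟩) | rfl)
  · obtain rfl : u = H i := Units.ext hu
    refine key _ (inv_eq_of_mul_eq_one_left (H_mul_self i)) (fun j => ?_) (fun j => ?_)
    · by_cases h : i = j
      · subst h
        rw [H_conj_X]; exact Z_mem i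
      · rw [(commute_H_X h).mul_inv_cancel]; exact X_mem j
    · by_cases h : i = j
      · subst h
        rw [H_conj_Z]; exact X_mem i
      · rw [(commute_H_Z h).mul_inv_cancel]; exact Z_mem j
  · obtain rfl : u = Z i := Units.ext hu
    exact Subgroup.le_normalizer (Z_mem i)
  · set j : Fin n := ⟨i + 1, hi⟩ with hj
    have hij : i ≠ j := Fin.ne_of_val_ne (by simp [hj])
    have hu' : (u : Mat n) = ctrl (Z i) (Z j) := by rw [hu, CZgate_eq_ctrl]
    have hu'' : (u : Mat n) = ctrl (Z j) (Z i) := by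
      rw [hu', ctrl_comm (commute_Z_Z.units_val)]
    have hcomm (p : (Mat n)ˣ) (h₁ : Commute p (Z i)) (h₂ : Commute p (Z j)) : Commute u p := by
      refine Units.ext (Eq.symm ?_)
      rw [Units.val_mul, Units.val_mul, hu']
      exact commute_ctrl (h₁.units_val) (h₂.units_val)
    have hflip {i j : Fin n} (hij : i ≠ j) (hu : (u : Mat n) = ctrl (Z i) (Z j)) :
        u * X i * u⁻¹ = Z j * X i := by
      refine conj_eq_of_val_eq_ctrl (c := Z i) ?_ (X_mul_self i) ?_ (X_mul_Z i) ?_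
      · rwa [mul_assoc, X_mul_self, mul_one]
      · rw [(commute_X_Z hij).mul_mul_mul_comm, Z_mul_self, X_mul_self, one_mul]
      · rw [mul_assoc, X_mul_Z, mul_neg, ← mul_assoc, ← mul_assoc,
          (commute_Z_Z (i := i) (j := j)).eq]
    refine key u (inv_eq_of_mul_eq_one_left (Units.ext ?_)) (fun k => ?_) (fun k => ?_)
    · rw [Units.val_mul, hu, CZgate_mul_self, Units.val_one]
    · by_cases hki : k = i
      · rw [hki, hflip hij hu']; exact mul_mem (Z_mem _) (X_mem _)
      by_cases hkj : k = j
      · rw [hkj, hflip hij.symm hu'']; exact mul_mem (Z_mem _) (X_mem _)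
      rw [(hcomm _ (commute_X_Z hki) (commute_X_Z hkj)).mul_inv_cancel]; exact X_mem k
    · rw [(hcomm _ commute_Z_Z commute_Z_Z).mul_inv_cancel]; exact Z_mem k
  · exact Subgroup.le_normalizer neg_one_mem

theorem ctrlRealizable_X_of_commute {i : Fin n} {b : (Mat n)ˣ} (hb : b ∈ PauliUnits n)
    (hbi : Commute b (X i)) : CtrlRealizable (X i) b := by
  have hH : (H i)⁻¹ = H i := inv_eq_of_mul_eq_one_left (H_mul_self i)
  have hcomm : Commute (H i * b * (H i)⁻¹) (Z i) := by
    rw [← H_conj_X, Commute, SemiconjBy, conj_mul, conj_mul, hbi.eq]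
  have := (ctrlRealizable_Z_of_commute (conj_mem_of_mem_ext (H_mem_ext i) hb) hcomm).conj
    (H_mem_ext i)
  rwa [H_conj_Z, hH, mul_assoc (H i) b, ← mul_assoc (H i) (H i), H_mul_self, one_mul, mul_assoc,
    H_mul_self, mul_one] at this

/-- Two Pauli involutions which both anticommute with `c`, one of the matrices `X i` and `Z i`, are
conjugate by a gate commuting with everything that commutes with `c` and `y * x`. -/
theorem exists_conj_of_anticommute {i : Fin n} {c x y : (Mat n)ˣ} (hc : c = X i ∨ c = Z i)
    (hx : x ∈ PauliUnits n) (hy : y ∈ PauliUnits n) (hx' : x * x = 1) (hy' : y * y = 1)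
    (hxc : x * c = -(c * x)) (hyc : y * c = -(c * y)) :
    ∃ g ∈ ExtGateGroup n, g * x * g⁻¹ = y ∧
      ∀ p, Commute p c → Commute p (y * x) → Commute p g := by
  have hcomm : Commute (y * x) c := by
    rw [Commute, SemiconjBy, mul_assoc, hxc, mul_neg, ← mul_assoc, hyc, neg_mul, neg_neg,
      mul_assoc]
  refine CtrlRealizable.exists_conj ?_ hx' hy' hxc hyc
  obtain rfl | rfl := hc
  · exact ctrlRealizable_X_of_commute (mul_mem hy hx) hcomm
  · exact ctrlRealizable_Z_of_commute (mul_mem hy hx) hcomm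

/-- A Pauli element commuting with all `X i` and `Z i` is central in the Pauli group. -/
theorem commute_of_forall_commute {y w : (Mat n)ˣ} (hX : ∀ i, Commute y (X i))
    (hZ : ∀ i, Commute y (Z i)) (hw : w ∈ PauliUnits n) : Commute y w := by
  have h : PauliUnits n ≤ Subgroup.centralizer {y} :=
    PauliUnits_le (fun i => Subgroup.mem_centralizer_singleton_iff.2 (hX i).eq.symm)
      (fun i => Subgroup.mem_centralizer_singleton_iff.2 (hZ i).eq.symm)
      (Subgroup.mem_centralizer_singleton_iff.2 (by simp))
  exact (Subgroup.mem_centralizer_singleton_iff.1 (h hw)).symm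

/-- The elements commuting with `X i` and `Z i` for all `i < k`. -/
def lowCentralizer (k : Fin n) : Subgroup (Mat n)ˣ :=
  Subgroup.centralizer {p | ∃ i < k, p = X i ∨ p = Z i}

theorem mem_lowCentralizer_iff {k : Fin n} {g : (Mat n)ˣ} :
    g ∈ lowCentralizer k ↔ ∀ i < k, Commute (X i) g ∧ Commute (Z i) g := by
  rw [lowCentralizer, Subgroup.mem_centralizer_iff]
  constructor
  · exact fun h i hi => ⟨h _ ⟨i, hi, .inl rfl⟩, h _ ⟨i, hi, .inr rfl⟩⟩
  · rintro h _ ⟨i, hi, rfl | rfl⟩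
    exacts [(h i hi).1, (h i hi).2]

theorem X_mem_lowCentralizer {k j : Fin n} (h : k ≤ j) : X j ∈ lowCentralizer k :=
  mem_lowCentralizer_iff.2 fun _ hi =>
    ⟨commute_X_X, (commute_X_Z (hi.trans_le h).ne').symm⟩

theorem Z_mem_lowCentralizer {k j : Fin n} (h : k ≤ j) : Z j ∈ lowCentralizer k :=
  mem_lowCentralizer_iff.2 fun _ hi => ⟨commute_X_Z (hi.trans_le h).ne, commute_Z_Z⟩

theorem exists_conj_of_mem_lowCentralizer {k j : Fin n} (hkj : k ≤ j) {c x y : (Mat n)ˣ}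
    (hc : c = X j ∨ c = Z j)
    (hx : x ∈ PauliUnits n) (hy : y ∈ PauliUnits n) (hx' : x * x = 1) (hy' : y * y = 1)
    (hxc : x * c = -(c * x)) (hyc : y * c = -(c * y))
    (hxk : x ∈ lowCentralizer k) (hyk : y ∈ lowCentralizer k) :
    ∃ g ∈ ExtGateGroup n, g * x * g⁻¹ = y ∧ g ∈ lowCentralizer k := by
  obtain ⟨g, hg, hgx, hgp⟩ := exists_conj_of_anticommute hc hx hy hx' hy' hxc hyc
  have hck : c ∈ lowCentralizer k := by
    obtain rfl | rfl := hc
    exacts [X_mem_lowCentralizer hkj, Z_mem_lowCentralizer hkj]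
  rw [mem_lowCentralizer_iff] at hxk hyk hck
  exact ⟨g, hg, hgx, mem_lowCentralizer_iff.2 fun i hi =>
    ⟨hgp _ (hck i hi).1 ((hyk i hi).1.mul_right (hxk i hi).1),
      hgp _ (hck i hi).2 ((hyk i hi).2.mul_right (hxk i hi).2)⟩⟩

theorem exists_conj_X_of_lt {k j : Fin n} (hkj : k < j) {c c' y : (Mat n)ˣ}
    (hc : c = X j ∨ c = Z j) (hc' : c' = X j ∨ c' = Z j) (hcc' : c' * c = -(c * c'))
    (hy : y ∈ PauliUnits n) (hy' : y * y = 1) (hyc : y * c = -(c * y))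
    (hyk : y ∈ lowCentralizer k) :
    ∃ g ∈ ExtGateGroup n, g * X k * g⁻¹ = y ∧ g ∈ lowCentralizer k := by
  have hXc : Commute (X k) c := by
    obtain rfl | rfl := hc
    exacts [commute_X_X, commute_X_Z hkj.ne]
  obtain ⟨hXc', hZc', hlow', hmem', hsq'⟩ : Commute (X k) c' ∧ Commute (Z k) c' ∧
      c' ∈ lowCentralizer k ∧ c' ∈ PauliUnits n ∧ c' * c' = 1 := by
    obtain rfl | rfl := hc'
    · exact ⟨commute_X_X, (commute_X_Z hkj.ne').symm, X_mem_lowCentralizer hkj.le, X_mem j,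
        X_mul_self j⟩
    · exact ⟨commute_X_Z hkj.ne, commute_Z_Z, Z_mem_lowCentralizer hkj.le, Z_mem j, Z_mul_self j⟩
  have hP : X k * c' ∈ PauliUnits n := mul_mem (X_mem k) hmem'
  have hsq : X k * c' * (X k * c') = 1 := by
    rw [hXc'.symm.mul_mul_mul_comm, X_mul_self, hsq', one_mul]
  have hlow : X k * c' ∈ lowCentralizer k := mul_mem (X_mem_lowCentralizer le_rfl) hlow'
  obtain ⟨g₁, hg₁, h₁, hg₁k⟩ := exists_conj_of_mem_lowCentralizer le_rfl (.inr rfl) (X_mem k) hP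
    (X_mul_self k) hsq (X_mul_Z k)
    (by rw [mul_assoc, ← hZc'.eq, ← mul_assoc, X_mul_Z, neg_mul, mul_assoc])
    (X_mem_lowCentralizer le_rfl) hlow
  obtain ⟨g₂, hg₂, h₂, hg₂k⟩ := exists_conj_of_mem_lowCentralizer hkj.le hc hP hy hsq hy'
    (by rw [mul_assoc, hcc', mul_neg, ← mul_assoc, hXc.eq, mul_assoc]) hyc hlow hyk
  refine ⟨g₂ * g₁, mul_mem hg₂ hg₁, ?_, mul_mem hg₂k hg₁k⟩
  rw [← h₂, ← h₁]
  group

theorem exists_conj_X {k : Fin n} {y w : (Mat n)ˣ} (hy : y ∈ PauliUnits n)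
    (hw : w ∈ PauliUnits n) (hy' : y * y = 1) (hyw : ¬Commute y w) (hyk : y ∈ lowCentralizer k) :
    ∃ g ∈ ExtGateGroup n, g * X k * g⁻¹ = y ∧ g ∈ lowCentralizer k := by
  obtain ⟨j, hj⟩ : ∃ j, ¬(Commute y (X j) ∧ Commute y (Z j)) := by
    by_contra! h
    exact hyw (commute_of_forall_commute (fun i => (h i).1) (fun i => (h i).2) hw)
  have hkj : k ≤ j := by
    by_contra! hjk
    have := mem_lowCentralizer_iff.1 hyk j hjk
    exact hj ⟨this.1.symm, this.2.symm⟩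
  have hanti : y * X j = -(X j * y) ∨ y * Z j = -(Z j * y) := by
    obtain h | h := not_and_or.1 hj
    · exact .inl ((commute_or_anticommute hy (X_mem j)).resolve_left h)
    · exact .inr ((commute_or_anticommute hy (Z_mem j)).resolve_left h)
  obtain hkj' | rfl := hkj.lt_or_eq
  · obtain h | h := hanti
    · exact exists_conj_X_of_lt hkj' (.inl rfl) (.inr rfl) (Z_mul_X j) hy hy' h hyk
    · exact exists_conj_X_of_lt hkj' (.inr rfl) (.inl rfl) (X_mul_Z j) hy hy' h hyk
  · obtain h | h := hanti
    · obtain ⟨g, hg, hgz, hgk⟩ := exists_conj_of_mem_lowCentralizer le_rfl (.inl rfl) (Z_mem k) hy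
        (Z_mul_self k) hy' (Z_mul_X k) h (Z_mem_lowCentralizer le_rfl) hyk
      refine ⟨g * H k, mul_mem hg (H_mem_ext k), ?_, mul_mem hgk ?_⟩
      · rw [← hgz, ← H_conj_X]
        group
      · exact mem_lowCentralizer_iff.2 fun i hi =>
          ⟨(commute_H_X hi.ne').symm, (commute_H_Z hi.ne').symm⟩
    · exact exists_conj_of_mem_lowCentralizer le_rfl (.inr rfl) (X_mem k) hy
        (X_mul_self k) hy' (X_mul_Z k) h (X_mem_lowCentralizer le_rfl) hyk

theorem conj_commute_iff (g : (Mat n)ˣ) {a b : (Mat n)ˣ} :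
    Commute (g * a * g⁻¹) (g * b * g⁻¹) ↔ Commute a b := by
  rw [Commute, SemiconjBy, conj_mul, conj_mul, Commute, SemiconjBy, mul_left_inj, mul_right_inj]

theorem exists_conj_Z {k : Fin n} {z : (Mat n)ˣ} (hz : z ∈ PauliUnits n) (hz' : z * z = 1)
    (hzX : ¬Commute z (X k)) (hzk : z ∈ lowCentralizer k) :
    ∃ g ∈ ExtGateGroup n, g * Z k * g⁻¹ = z ∧ Commute g (X k) ∧ g ∈ lowCentralizer k := by
  have h := (commute_or_anticommute hz (X_mem k)).resolve_left hzX
  obtain ⟨g, hg, hgz, hgp⟩ := exists_conj_of_anticommute (.inl rfl) (Z_mem k) hz (Z_mul_self k)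
    hz' (Z_mul_X k) h
  refine ⟨g, hg, hgz, (hgp _ (Commute.refl _) ?_).symm, mem_lowCentralizer_iff.2 fun i hi => ?_⟩
  · rw [Commute, SemiconjBy, mul_assoc, Z_mul_X, mul_neg, ← mul_assoc, ← mul_assoc, h, neg_mul,
      neg_neg]
  · have hzi := mem_lowCentralizer_iff.1 hzk i hi
    exact ⟨hgp _ commute_X_X (hzi.1.mul_right (commute_X_Z hi.ne)),
      hgp _ (commute_X_Z hi.ne').symm (hzi.2.mul_right commute_Z_Z)⟩

/-- An anticommuting pair of Pauli involutions supported on the qubits `≥ k` is conjugate to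
`(X k, Z k)` by a gate supported on these qubits. -/
theorem exists_conj_X_Z {k : Fin n} {y w : (Mat n)ˣ} (hy : y ∈ PauliUnits n)
    (hw : w ∈ PauliUnits n) (hy' : y * y = 1) (hw' : w * w = 1) (hyw : ¬Commute y w)
    (hyk : y ∈ lowCentralizer k) (hwk : w ∈ lowCentralizer k) :
    ∃ g ∈ ExtGateGroup n, g * X k * g⁻¹ = y ∧ g * Z k * g⁻¹ = w ∧ g ∈ lowCentralizer k := by
  obtain ⟨g, hg, hgy, hgk⟩ := exists_conj_X hy hw hy' hyw hyk
  set z := g⁻¹ * w * g with hz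
  have hgz : g * z * g⁻¹ = w := by rw [hz]; group
  have hzP : z ∈ PauliUnits n := by simpa using conj_mem_of_mem_ext (inv_mem hg) hw
  have hz' : z * z = 1 := by
    rw [hz, show g⁻¹ * w * g * (g⁻¹ * w * g) = g⁻¹ * (w * w) * g by group, hw']
    group
  have hzX : ¬Commute z (X k) := by
    rw [← conj_commute_iff g, hgz, hgy]
    exact fun h => hyw h.symm
  obtain ⟨g', hg', hgz', hgX, hgk'⟩ := exists_conj_Z hzP hz' hzX
    (mul_mem (mul_mem (inv_mem hgk) hwk) hgk)
  refine ⟨g * g', mul_mem hg hg', ?_, ?_, mul_mem hgk hgk'⟩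
  · rw [← hgy, _root_.mul_inv_rev, ← mul_assoc, mul_assoc g g', mul_assoc g, hgX.mul_inv_cancel]
  · rw [← hgz, ← hgz']
    group

theorem exists_conj_eq_of_lt (φ : MulAut (PauliUnits n)) (k : ℕ) (hk : k ≤ n) :
    ∃ U ∈ ExtGateGroup n, ∀ i : Fin n, (i : ℕ) < k →
      U * X i * U⁻¹ = φ ⟨X i, X_mem i⟩ ∧ U * Z i * U⁻¹ = φ ⟨Z i, Z_mem i⟩ := by
  induction k with
  | zero => exact ⟨1, one_mem _, fun i hi => absurd hi (Nat.not_lt_zero _)⟩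
  | succ k ih =>
    obtain ⟨U, hU, hUi⟩ := ih (by omega)
    set m : Fin n := ⟨k, hk⟩
    set ψ : PauliUnits n → (Mat n)ˣ := fun p => U⁻¹ * φ p * U with hψ
    have hψc (p : PauliUnits n) : U * ψ p * U⁻¹ = φ p := by simp only [hψ]; group
    have hψP (p : PauliUnits n) : ψ p ∈ PauliUnits n := by
      simpa using conj_mem_of_mem_ext (inv_mem hU) (φ p).2
    have hψsq (p : PauliUnits n) (h : (p : (Mat n)ˣ) * p = 1) : ψ p * ψ p = 1 := by
      have h' : (φ p : (Mat n)ˣ) * φ p = 1 := by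
        rw [← Subgroup.coe_mul, ← map_mul, show p * p = 1 from Subtype.ext h, map_one,
          Subgroup.coe_one]
      simp only [hψ]
      rw [show U⁻¹ * (φ p : (Mat n)ˣ) * U * (U⁻¹ * φ p * U) = U⁻¹ * (φ p * φ p) * U by group, h']
      group
    have hψcomm (p q : PauliUnits n) : Commute (ψ p) (ψ q) ↔ Commute (p : (Mat n)ˣ) q := by
      rw [← conj_commute_iff U, hψc, hψc]
      constructor
      · intro h
        have h' : φ (p * q) = φ (q * p) := by
          rw [map_mul, map_mul]
          exact Subtype.ext h
        exact congrArg Subtype.val (φ.injective h')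
      · intro h
        have h' : p * q = q * p := Subtype.ext h
        have := congrArg Subtype.val (congrArg φ h')
        rwa [map_mul, map_mul] at this
    have hψX (i : Fin n) (hi : i < m) : ψ ⟨X i, X_mem i⟩ = X i := by
      simp only [hψ, ← (hUi i hi).1]; group
    have hψZ (i : Fin n) (hi : i < m) : ψ ⟨Z i, Z_mem i⟩ = Z i := by
      simp only [hψ, ← (hUi i hi).2]; group
    obtain ⟨g, hg, hgX, hgZ, hgm⟩ := exists_conj_X_Z (k := m) (hψP ⟨X m, X_mem m⟩)
      (hψP ⟨Z m, Z_mem m⟩) (hψsq _ (X_mul_self m)) (hψsq _ (Z_mul_self m))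
      (by
        rw [hψcomm]
        exact fun h => ne_neg_self _ (h.eq.symm.trans (X_mul_Z m)))
      (mem_lowCentralizer_iff.2 fun i hi => by
        rw [← hψX i hi, ← hψZ i hi, hψcomm, hψcomm]
        exact ⟨commute_X_X, (commute_X_Z hi.ne').symm⟩)
      (mem_lowCentralizer_iff.2 fun i hi => by
        rw [← hψX i hi, ← hψZ i hi, hψcomm, hψcomm]
        exact ⟨commute_X_Z hi.ne, commute_Z_Z⟩)
    have hUg (p : (Mat n)ˣ) : U * g * p * (U * g)⁻¹ = U * (g * p * g⁻¹) * U⁻¹ := by group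
    refine ⟨U * g, mul_mem hU hg, fun i hi => ?_⟩
    rw [hUg, hUg]
    obtain h | h := Nat.lt_succ_iff_lt_or_eq.1 hi
    · have hgi := mem_lowCentralizer_iff.1 hgm i h
      rw [hgi.1.symm.mul_inv_cancel, hgi.2.symm.mul_inv_cancel]
      exact hUi i h
    · obtain rfl : i = m := Fin.ext h
      rw [hgX, hgZ, hψc, hψc]
      exact ⟨rfl, rfl⟩

theorem coe_map_neg_one (φ : MulAut (PauliUnits n)) :
    (φ ⟨-1, neg_one_mem⟩ : (Mat n)ˣ) = -1 := by
  set e : PauliUnits n := ⟨-1, neg_one_mem⟩ with he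
  have hcomm (p : (Mat n)ˣ) (hp : p ∈ PauliUnits n) : Commute p (φ e) := by
    have h : e * φ.symm ⟨p, hp⟩ = φ.symm ⟨p, hp⟩ * e :=
      Subtype.ext (Commute.neg_one_left _)
    have h' := congrArg φ h
    rw [map_mul, map_mul, MulEquiv.apply_symm_apply] at h'
    exact (congrArg Subtype.val h').symm
  obtain ⟨s, hs⟩ := exists_eq_smul_one (fun i => (hcomm _ (X_mem i)).units_val)
    (fun i => (hcomm _ (Z_mem i)).units_val)
  have hsq : (φ e : (Mat n)ˣ) * φ e = 1 := by
    have : e * e = 1 := Subtype.ext (by simp [he])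
    rw [← Subgroup.coe_mul, ← map_mul, this, map_one, Subgroup.coe_one]
  have hs2 : s * s = 1 := by
    have := congrArg Units.val hsq
    rw [Units.val_mul, hs, smul_mul_smul_comm, mul_one, Units.val_one] at this
    simpa using congrFun (congrFun this 0) 0
  obtain rfl | rfl := mul_self_eq_one_iff.1 hs2
  · have h1 : φ e = 1 := Subtype.ext (Units.ext (by rw [hs, one_smul]; rfl))
    rw [map_eq_one_iff φ φ.injective] at h1
    exact absurd (congrArg Subtype.val h1).symm (ne_neg_self 1)
  · ext1
    rw [hs, neg_smul, one_smul, Units.val_neg, Units.val_one]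

theorem det_sq_eq_one_of_mem_ext {U : (Mat n)ˣ} (hU : U ∈ ExtGateGroup n) :
    (U : Mat n).det ^ 2 = 1 := by
  have key {M : Mat n} (h : M * M = 1) : M.det ^ 2 = 1 := by rw [sq, ← det_mul, h, det_one]
  induction hU using Subgroup.closure_induction with
  | mem u hu =>
    apply key
    obtain (⟨i, hu⟩ | ⟨i, hu⟩ | ⟨i, hi, hu⟩) | rfl := hu
    · rw [hu]; exact (H i).mul_inv
    · rw [hu]; exact (Z i).mul_inv
    · rw [hu]; exact CZgate_mul_self _ _
    · simp
  | one => simp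
  | mul a b _ _ ha hb => rw [Units.val_mul, det_mul, mul_pow, ha, hb, one_mul]
  | inv a _ ha =>
    have : ((a⁻¹ : (Mat n)ˣ) : Mat n).det * (a : Mat n).det = 1 := by
      rw [← det_mul, Units.inv_mul, det_one]
    rw [← mul_one (_ ^ 2), ← ha, ← mul_pow, this, one_pow, ha]

theorem eq_or_eq_neg_of_conj_eq {U V : (Mat n)ˣ} (hU : U ∈ ExtGateGroup n)
    (hV : V ∈ ExtGateGroup n) (h : ∀ p ∈ PauliUnits n, U * p * U⁻¹ = V * p * V⁻¹) :
    V = U ∨ V = -U := by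
  have hcomm (p : (Mat n)ˣ) (hp : p ∈ PauliUnits n) : Commute p (U⁻¹ * V) := by
    rw [Commute, SemiconjBy, ← mul_left_inj V⁻¹, ← mul_right_inj U]
    simpa [mul_assoc] using h p hp
  obtain ⟨s, hs⟩ := exists_eq_smul_one (fun i => (hcomm _ (X_mem i)).units_val)
    (fun i => (hcomm _ (Z_mem i)).units_val)
  have hdet := det_sq_eq_one_of_mem_ext (mul_mem (inv_mem hU) hV)
  rw [hs, det_smul, det_one, mul_one, ← pow_mul] at hdet
  have hVU : (V : Mat n) = U * (U⁻¹ * V : (Mat n)ˣ) := by rw [← Units.val_mul, mul_inv_cancel_left]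
  rw [hs, mul_smul_comm, mul_one] at hVU
  obtain h1 | h1 := eq_or_eq_neg_of_abs_eq
    ((abs_pow_eq_one s (mul_ne_zero Fintype.card_ne_zero two_ne_zero)).1 (by rw [hdet, abs_one]))
  · left
    ext1
    rw [hVU, h1, one_smul]
  · right
    ext1
    rw [hVU, h1, neg_smul, one_smul, Units.val_neg]

end Gates

/-- Every group automorphism `φ` of `P_n` is realized by conjugation
by some element `U` of the extended gate group `G_n'`, and `U` is unique up to sign. -/
theorem exists_gate_realizing_aut (n : ℕ) (φ : MulAut ↥(PauliUnits n)) :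
    (∃ U ∈ ExtGateGroup n, ∀ P : ↥(PauliUnits n),
        (U : Mat n) * ((P : (Mat n)ˣ) : Mat n) * ((U⁻¹ : (Mat n)ˣ) : Mat n) =
          ((φ P : (Mat n)ˣ) : Mat n)) ∧
    ∀ U ∈ ExtGateGroup n, ∀ V ∈ ExtGateGroup n,
      (∀ P : ↥(PauliUnits n),
        (U : Mat n) * ((P : (Mat n)ˣ) : Mat n) * ((U⁻¹ : (Mat n)ˣ) : Mat n) =
          ((φ P : (Mat n)ˣ) : Mat n)) →
      (∀ P : ↥(PauliUnits n),
        (V : Mat n) * ((P : (Mat n)ˣ) : Mat n) * ((V⁻¹ : (Mat n)ˣ) : Mat n) =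
          ((φ P : (Mat n)ˣ) : Mat n)) →
      V = U ∨ V = -U := by
  refine ⟨?_, fun U hU V hV hUφ hVφ => ?_⟩
  · obtain ⟨U, hU, hUi⟩ := exists_conj_eq_of_lt φ n le_rfl
    let K : Subgroup (PauliUnits n) :=
      ((MulAut.conj U).toMonoidHom.comp (PauliUnits n).subtype).eqLocus
        ((PauliUnits n).subtype.comp φ.toMonoidHom)
    have hK : PauliUnits n ≤ K.map (PauliUnits n).subtype :=
      PauliUnits_le (fun i => ⟨⟨X i, X_mem i⟩, (hUi i i.2).1, rfl⟩)
        (fun i => ⟨⟨Z i, Z_mem i⟩, (hUi i i.2).2, rfl⟩)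
        ⟨⟨-1, neg_one_mem⟩, by simp [K, MonoidHom.eqLocus, coe_map_neg_one], rfl⟩
    refine ⟨U, hU, fun P => ?_⟩
    obtain ⟨Q, hQ, hQP⟩ := hK P.2
    obtain rfl : Q = P := Subtype.ext hQP
    exact congrArg Units.val hQ
  · exact eq_or_eq_neg_of_conj_eq hU hV fun p hp =>
      Units.ext ((hUφ ⟨p, hp⟩).trans (hVφ ⟨p, hp⟩).symm)

end RealStab

end
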